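/- arXiv:0910.3087 — 5 statements merged into one kernel-verified Lean document; each statement's English description precedes it below -/
import Mathlib

section
/- Let a, b ∈ ℂ and suppose neither 2b nor b + 1/2 is a nonpositive integer. Then there is an open neighborhood U of 0 in ℂ such that for all x ∈ U, ₂F₁(2a, b; 2b; x) = (1 - x/2)^(-2a) · ₂F₁(a, a+1/2; b+1/2; x²/(2-x)²). -/
open Complex

open Filter Topology

/-- The derivative of a power series, with its coefficients. -/
lemma hyp_deriv_series {f : ℂ → ℂ} {p : FormalMultilinearSeries ℂ ℂ ℂ} {r : ENNReal}
    (h : HasFPowerSeriesOnBall f p 0 r) :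
    ∃ q : FormalMultilinearSeries ℂ ℂ ℂ, HasFPowerSeriesOnBall (deriv f) q 0 r ∧
      ∀ n, q.coeff n = (n + 1) * p.coeff (n + 1) := by
  refine ⟨(ContinuousLinearMap.apply ℂ ℂ (1 : ℂ)).compFormalMultilinearSeries p.derivSeries,
    ?_, ?_⟩
  · have := (ContinuousLinearMap.apply ℂ ℂ (1 : ℂ)).comp_hasFPowerSeriesOnBall h.fderiv
    refine this.congr ?_
    intro z hz
    simp
  · intro n
    have := p.derivSeries_coeff_one n
    simp only [nsmul_eq_mul, Nat.cast_add, Nat.cast_one] at this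
    rw [← this]
    rfl

lemma hyp_hasSum {f : ℂ → ℂ} {p : FormalMultilinearSeries ℂ ℂ ℂ} {r : ENNReal}
    (h : HasFPowerSeriesOnBall f p 0 r) {z : ℂ} (hz : z ∈ Metric.eball (0 : ℂ) r) :
    HasSum (fun n => p.coeff n * z ^ n) (f z) := by
  have := h.hasSum hz
  simpa [mul_comm] using this

lemma hyp_radius (a b c : ℂ) :
    1 ≤ (ordinaryHypergeometricSeries ℂ a b c).radius := by
  by_cases ha : ∃ k : ℕ, (k : ℂ) = -a
  · obtain ⟨k, hk⟩ := ha
    obtain rfl : a = -(k : ℂ) := by rw [hk]; ring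
    simp [ordinaryHypergeometric_radius_top_of_neg_nat₁]
  by_cases hb : ∃ k : ℕ, (k : ℂ) = -b
  · obtain ⟨k, hk⟩ := hb
    obtain rfl : b = -(k : ℂ) := by rw [hk]; ring
    simp [ordinaryHypergeometric_radius_top_of_neg_nat₂]
  by_cases hc : ∃ k : ℕ, (k : ℂ) = -c
  · obtain ⟨k, hk⟩ := hc
    obtain rfl : c = -(k : ℂ) := by rw [hk]; ring
    simp [ordinaryHypergeometric_radius_top_of_neg_nat₃]
  push Not at ha hb hc
  rw [ordinaryHypergeometricSeries_radius_eq_one ℂ a b c fun k => ⟨ha k, hb k, hc k⟩]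

lemma hyp_series (a b c : ℂ) :
    HasFPowerSeriesOnBall (ordinaryHypergeometric a b c : ℂ → ℂ)
      (ordinaryHypergeometricSeries ℂ a b c) 0 1 := by
  have h1 := hyp_radius a b c
  exact ((ordinaryHypergeometricSeries ℂ a b c).hasFPowerSeriesOnBall
    (lt_of_lt_of_le one_pos h1)).mono one_pos h1

lemma hyp_coeff (a b c : ℂ) (hc : ∀ n : ℕ, c ≠ -(n : ℂ)) (n : ℕ) :
    (n + 1) * (n + c) * (ordinaryHypergeometricSeries ℂ a b c).coeff (n + 1) =
      (n + a) * (n + b) * (ordinaryHypergeometricSeries ℂ a b c).coeff n := by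
  have h0 : (n : ℂ) + c ≠ 0 := fun h => hc n (by linear_combination h)
  have h1 : (n : ℂ) + 1 ≠ 0 := by exact_mod_cast Nat.succ_ne_zero n
  have h2 : (n.factorial : ℂ) ≠ 0 := by exact_mod_cast n.factorial_ne_zero
  have h3 : (ascPochhammer ℂ n).eval c ≠ 0 := by
    rw [Ne, ascPochhammer_eval_eq_zero_iff]
    rintro ⟨k, -, hk⟩
    exact hc k (by rw [hk]; ring)
  have h0' : c + (n : ℂ) ≠ 0 := by rwa [add_comm]
  simp only [ordinaryHypergeometricSeries, FormalMultilinearSeries.coeff_ofScalars,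
    ordinaryHypergeometricCoefficient, ascPochhammer_succ_eval, Nat.factorial_succ, Nat.cast_mul,
    Nat.cast_add, Nat.cast_one]
  field_simp
  ring

lemma hyp_ode (a b c : ℂ) (hc : ∀ n : ℕ, c ≠ -(n : ℂ)) {z : ℂ}
    (hz : z ∈ Metric.eball (0 : ℂ) 1) :
    z * (1 - z) * deriv (deriv (ordinaryHypergeometric a b c)) z
      + (c - (a + b + 1) * z) * deriv (ordinaryHypergeometric a b c) z
      - a * b * ordinaryHypergeometric a b c z = 0 := by
  have s0 := hyp_series a b c
  obtain ⟨q, s1, hq⟩ := hyp_deriv_series s0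
  obtain ⟨t, s2, ht⟩ := hyp_deriv_series s1
  have S0 := hyp_hasSum s0 hz
  have S1 := hyp_hasSum s1 hz
  have S2 := hyp_hasSum s2 hz
  have hco := hyp_coeff a b c hc
  set u := (ordinaryHypergeometricSeries ℂ a b c).coeff
  have T1 : HasSum (fun n : ℕ => n * u n * z ^ n)
      (z * deriv (ordinaryHypergeometric a b c) z) := by
    rw [← hasSum_nat_add_iff' 1]
    convert! S1.mul_left z using 1
    · funext n
      rw [hq]; push_cast; ring
    · simp
  have T2 : HasSum (fun n : ℕ => n * ((n + 1) * u (n + 1)) * z ^ n)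
      (z * deriv (deriv (ordinaryHypergeometric a b c)) z) := by
    rw [← hasSum_nat_add_iff' 1]
    convert! S2.mul_left z using 1
    · funext n
      rw [ht, hq]; push_cast; ring
    · simp
  have T3 : HasSum (fun n : ℕ => n * (n - 1) * u n * z ^ n)
      (z ^ 2 * deriv (deriv (ordinaryHypergeometric a b c)) z) := by
    rw [← hasSum_nat_add_iff' 2]
    convert! S2.mul_left (z ^ 2) using 1
    · funext n
      rw [ht, hq]; push_cast; ring
    · simp [Finset.sum_range_succ]
  have key := (((T2.sub T3).add (S1.mul_left c)).sub (T1.mul_left (a + b + 1))).sub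
    (S0.mul_left (a * b))
  have hzero : (fun n : ℕ => n * ((n + 1) * u (n + 1)) * z ^ n - n * (n - 1) * u n * z ^ n
      + c * (q.coeff n * z ^ n) - (a + b + 1) * (n * u n * z ^ n) - a * b * (u n * z ^ n))
      = fun _ => (0 : ℂ) := by
    funext n
    rw [hq]
    linear_combination z ^ n * hco n
  have := (hzero ▸ key).unique hasSum_zero
  linear_combination this

/-- An analytic solution of the hypergeometric equation vanishing at the origin is zero. -/
lemma ode_unique (C D E : ℂ) (hC : ∀ n : ℕ, C ≠ -(n : ℂ)) (H : ℂ → ℂ)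
    (hH : AnalyticAt ℂ H 0) (h0 : H 0 = 0)
    (hode : ∀ᶠ z in 𝓝 (0 : ℂ), z * (1 - z) * deriv (deriv H) z + (C - D * z) * deriv H z
      - E * H z = 0) : ∀ᶠ z in 𝓝 (0 : ℂ), H z = 0 := by
  by_contra hne
  obtain ⟨n, g, hg, hg0, hHg⟩ := hH.exists_eventuallyEq_pow_smul_nonzero_iff.mpr hne
  simp only [sub_zero, smul_eq_mul] at hHg
  obtain _ | m := n
  · have := hHg.self_of_nhds
    simp [h0] at this
    exact hg0 this.symm
  set g1 : ℂ → ℂ := fun z => (m + 1) * g z + z * deriv g z with hg1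
  have hg1a : AnalyticAt ℂ g1 0 := by
    have := hg.deriv
    fun_prop
  have hd1 : ∀ᶠ z in 𝓝 (0 : ℂ), deriv H z = z ^ m * g1 z := by
    filter_upwards [hHg.eventually_nhds, hg.eventually_analyticAt] with z hz hgz
    rw [EventuallyEq.deriv_eq hz]
    have := ((hasDerivAt_id z).pow (m + 1)).mul hgz.differentiableAt.hasDerivAt
    refine HasDerivAt.deriv (this.congr_deriv ?_)
    simp [hg1]; ring
  have hd2 : ∀ᶠ z in 𝓝 (0 : ℂ), z * deriv (deriv H) z = z ^ m * (m * g1 z + z * deriv g1 z) := by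
    filter_upwards [hd1.eventually_nhds, hg1a.eventually_analyticAt] with z hz hgz
    rw [EventuallyEq.deriv_eq hz]
    have := ((hasDerivAt_id z).pow m).mul hgz.differentiableAt.hasDerivAt
    have h2 : deriv (fun z => z ^ m * g1 z) z = m * z ^ (m - 1) * g1 z + z ^ m * deriv g1 z :=
      HasDerivAt.deriv (this.congr_deriv (by simp))
    rw [h2]
    obtain _ | k := m
    · simp
    · simp; ring
  set B : ℂ → ℂ := fun z => (1 - z) * (m * g1 z + z * deriv g1 z) + (C - D * z) * g1 z
    - E * z * g z with hB
  have hBc : ContinuousAt B 0 := by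
    have h1 := hg.continuousAt
    have h2 := hg1a.continuousAt
    have h3 := hg1a.deriv.continuousAt
    fun_prop
  have hB0 : ∀ᶠ z in 𝓝[≠] (0 : ℂ), B z = 0 := by
    filter_upwards [nhdsWithin_le_nhds hd1, nhdsWithin_le_nhds hd2, nhdsWithin_le_nhds hHg,
      nhdsWithin_le_nhds hode, self_mem_nhdsWithin] with z h1 h2 h3 h4 h5
    have h5 : z ≠ 0 := h5
    have : z ^ m * B z = 0 := by
      rw [← h4, h1, h3, hB]
      linear_combination (-(1 - z)) * h2
    simpa [h5] using this
  have hBz : B 0 = 0 :=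
    tendsto_nhds_unique_of_eventuallyEq (hBc.tendsto.mono_left nhdsWithin_le_nhds)
      tendsto_const_nhds hB0
  have : (m + C) * ((m + 1) * g 0) = 0 := by
    simp [hB, hg1] at hBz
    linear_combination hBz
  have hm : (m : ℂ) + 1 ≠ 0 := by exact_mod_cast Nat.succ_ne_zero m
  have hm2 : (m : ℂ) + C ≠ 0 := fun h => hC m (by linear_combination h)
  simp [hm, hm2, hg0] at this

theorem stmt1 (a b : ℂ) (hc1 : ∀ n : ℕ, 2*b ≠ -(n : ℂ))
    (hc2 : ∀ n : ℕ, b + 1/2 ≠ -(n : ℂ)) :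
    ∃ U : Set ℂ, IsOpen U ∧ (0 : ℂ) ∈ U ∧ ∀ x ∈ U,
      ordinaryHypergeometric (2*a) b (2*b) x =
        (1 - x/2) ^ (-(2*a)) * ordinaryHypergeometric a (a + 1/2) (b + 1/2) (x^2 / (2 - x)^2) := by
  set F : ℂ → ℂ := ordinaryHypergeometric (2*a) b (2*b) with hF
  set K : ℂ → ℂ := ordinaryHypergeometric a (a + 1/2) (b + 1/2) with hK
  set G : ℂ → ℂ := fun x => (1 - x/2) ^ (-(2*a)) * K (x^2 / (2 - x)^2) with hG
  have hKs := hyp_series a (a + 1/2) (b + 1/2)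
  have hFa : AnalyticAt ℂ F 0 := (hyp_series (2*a) b (2*b)).analyticAt
  have hyc : ContinuousAt (fun x : ℂ => x^2 / (2 - x)^2) 0 := by
    have : (2 - (0:ℂ))^2 ≠ 0 := by norm_num
    fun_prop (disch := assumption)
  have hball : Metric.eball (0 : ℂ) 1 ∈ 𝓝 (0 : ℂ) := Metric.eball_mem_nhds _ one_pos
  have ey : ∀ᶠ x in 𝓝 (0 : ℂ), x^2 / (2 - x)^2 ∈ Metric.eball (0 : ℂ) 1 := by
    apply hyc
    simpa using hball
  have es : ∀ᶠ x in 𝓝 (0 : ℂ), 1 - x/2 ∈ slitPlane := by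
    have : ContinuousAt (fun x : ℂ => 1 - x/2) 0 := by fun_prop
    apply this
    exact isOpen_slitPlane.mem_nhds (by simp)
  have e2 : ∀ᶠ x in 𝓝 (0 : ℂ), 2 - x ≠ 0 := by
    filter_upwards [es] with x hx h
    apply slitPlane_ne_zero hx
    linear_combination h / 2
  have hKan : ∀ y ∈ Metric.eball (0 : ℂ) 1, AnalyticAt ℂ K y := fun y hy =>
    hKs.analyticAt_of_mem hy
  have hyd : ∀ x : ℂ, 2 - x ≠ 0 →
      HasDerivAt (fun x : ℂ => x^2 / (2 - x)^2) (4 * x / (2 - x)^3) x := by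
    intro x hx
    have h1 : HasDerivAt (fun x : ℂ => x^2) (2 * x) x := by
      simpa using hasDerivAt_pow 2 x
    have h2 : HasDerivAt (fun x : ℂ => (2 - x)^2) (2 * (2 - x) * (-1)) x := by
      have h3 : HasDerivAt (fun x : ℂ => 2 - x) (-1) x := (hasDerivAt_id x).const_sub 2
      simpa using h3.fun_pow 2
    refine (h1.div h2 (pow_ne_zero 2 hx)).congr_deriv ?_
    field_simp
    ring
  have hPd : ∀ x : ℂ, 2 - x ≠ 0 → 1 - x/2 ∈ slitPlane →
      HasDerivAt (fun x : ℂ => (1 - x/2) ^ (-(2*a)))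
        ((1 - x/2) ^ (-(2*a)) * (2 * a / (2 - x))) x := by
    intro x hx hs
    have h1 : HasDerivAt (fun x : ℂ => 1 - x/2) (-(1/2)) x := by
      simpa using ((hasDerivAt_id x).div_const 2).const_sub 1
    refine (h1.cpow_const hs).congr_deriv ?_
    have h3 : 1 - x/2 ≠ 0 := slitPlane_ne_zero hs
    rw [cpow_sub _ _ h3, cpow_one]
    have h4 : 1 - x/2 = (2 - x)/2 := by ring
    generalize (1 - x/2) ^ (-(2*a)) = P
    rw [h4]
    field_simp
  have hGd : ∀ᶠ x in 𝓝 (0 : ℂ), HasDerivAt G ((1 - x/2) ^ (-(2*a)) *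
      (2 * a / (2 - x) * K (x^2 / (2 - x)^2) +
        4 * x / (2 - x)^3 * deriv K (x^2 / (2 - x)^2))) x := by
    filter_upwards [ey, es, e2] with x hy hs h2
    have h := (hPd x h2 hs).mul
      (HasDerivAt.comp x (hKan _ hy).differentiableAt.hasDerivAt (hyd x h2))
    refine h.congr_deriv ?_
    simp only [Function.comp]
    ring
  have hGa : AnalyticAt ℂ G 0 := by
    rw [Complex.analyticAt_iff_eventually_differentiableAt]
    filter_upwards [hGd] with x hx using hx.differentiableAt
  have hGdd : ∀ᶠ x in 𝓝 (0 : ℂ), deriv (deriv G) x = (1 - x/2) ^ (-(2*a)) *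
      (2 * a / (2 - x) * (2 * a / (2 - x) * K (x^2 / (2 - x)^2) +
        4 * x / (2 - x)^3 * deriv K (x^2 / (2 - x)^2)) +
       (2 * a / (2 - x)^2 * K (x^2 / (2 - x)^2)
        + 2 * a / (2 - x) * (4 * x / (2 - x)^3 * deriv K (x^2 / (2 - x)^2))
        + (4 / (2 - x)^3 + 12 * x / (2 - x)^4) * deriv K (x^2 / (2 - x)^2)
        + (4 * x / (2 - x)^3)^2 * deriv (deriv K) (x^2 / (2 - x)^2))) := by
    filter_upwards [ey, es, e2, hGd.eventually_nhds] with x hy hs h2 hd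
    have hd' : deriv G =ᶠ[𝓝 x] _ := hd.mono fun x hx => hx.deriv
    rw [hd'.deriv_eq]
    have hk1 := HasDerivAt.comp x (hKan _ hy).differentiableAt.hasDerivAt (hyd x h2)
    have hk2 := HasDerivAt.comp x (hKan _ hy).deriv.differentiableAt.hasDerivAt (hyd x h2)
    have hr : HasDerivAt (fun x : ℂ => 2 - x) (-1) x := by
      simpa using (hasDerivAt_id x).const_sub 2
    have hr1 : HasDerivAt (fun x : ℂ => 2 * a / (2 - x)) (2 * a / (2 - x)^2) x := by
      refine ((hasDerivAt_const x (2 * a)).div hr h2).congr_deriv ?_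
      field_simp
      ring
    have hr2 : HasDerivAt (fun x : ℂ => 4 * x / (2 - x)^3)
        (4 / (2 - x)^3 + 12 * x / (2 - x)^4) x := by
      refine (((hasDerivAt_id x).const_mul 4).div (hr.pow 3) (pow_ne_zero 3 h2)).congr_deriv ?_
      simp
      field_simp
      ring
    have h := (hPd x h2 hs).mul ((hr1.mul hk1).add (hr2.mul hk2))
    refine HasDerivAt.deriv (h.congr_deriv ?_)
    simp only [Function.comp, Pi.mul_apply, Pi.add_apply]
    ring
  have hGode : ∀ᶠ x in 𝓝 (0 : ℂ), x * (1 - x) * deriv (deriv G) x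
      + (2 * b - (2 * a + b + 1) * x) * deriv G x - 2 * a * b * G x = 0 := by
    filter_upwards [ey, e2, hGd, hGdd] with x hy h2 hd hdd
    have ho := hyp_ode a (a + 1/2) (b + 1/2) hc2 hy
    rw [hdd, hd.deriv]
    simp only [hG]
    rw [← hK] at ho
    generalize deriv (deriv K) (x^2 / (2 - x)^2) = k2 at *
    generalize deriv K (x^2 / (2 - x)^2) = k1 at *
    generalize K (x^2 / (2 - x)^2) = k0 at *
    generalize (1 - x/2) ^ (-(2*a)) = P at *
    have : P * (4 * x / (2 - x)^2) * (x^2 / (2 - x)^2 * (1 - x^2 / (2 - x)^2) * k2 +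
        (b + 1/2 - (a + (a + 1/2) + 1) * (x^2 / (2 - x)^2)) * k1 - a * (a + 1/2) * k0) = 0 := by
      rw [ho, mul_zero]
    rw [← this]
    field_simp
    ring
  have hsub := ode_unique (2 * b) (2 * a + b + 1) (2 * a * b) hc1 (fun x => F x - G x)
    (hFa.sub hGa) (by simp [hF, hG, hK]) (by
      filter_upwards [hGode, hball, hFa.eventually_analyticAt.eventually_nhds,
        hGa.eventually_analyticAt.eventually_nhds] with x h1 h2 h3 h4
      have ho := hyp_ode (2*a) b (2*b) hc1 h2
      rw [← hF] at ho
      have hd : deriv (fun x => F x - G x) =ᶠ[𝓝 x] fun x => deriv F x - deriv G x := by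
        filter_upwards [h3, h4] with y h5 h6
        exact deriv_fun_sub h5.differentiableAt h6.differentiableAt
      have hdd : deriv (deriv (fun x => F x - G x)) x = deriv (deriv F) x - deriv (deriv G) x := by
        rw [hd.deriv_eq]
        exact deriv_fun_sub h3.self_of_nhds.deriv.differentiableAt
          h4.self_of_nhds.deriv.differentiableAt
      rw [hdd, hd.self_of_nhds]
      linear_combination ho - h1)
  obtain ⟨U, hU, hUo, hU0⟩ := eventually_nhds_iff.mp hsub
  exact ⟨U, hUo, hU0, fun x hx => sub_eq_zero.mp (hU x hx)⟩
end

section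
/- Let a ∈ ℂ and suppose 2a + 5/6 is not a nonpositive integer. Then there is an open neighborhood U of 0 in ℂ such that for all x ∈ U, ₂F₁(3a, 1/3 - a; 2a + 5/6; x) = (1 - 4x)^(-3a) · ₂F₁(a, a + 1/3; 2a + 5/6; 27x/(4x-1)³). -/
open Complex

open Filter Topology in
theorem hyp_theta_aux (u : ℕ → ℂ) (f : ℂ → ℂ) (r : ℝ)
    (hf : ∀ x ∈ Metric.ball (0 : ℂ) r, HasSum (fun n => u n * x ^ n) (f x)) :
    ∀ x ∈ Metric.ball (0 : ℂ) r,
      DifferentiableAt ℂ f x ∧ HasSum (fun n => (n * u n) * x ^ n) (x * deriv f x) := by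
  intro x hx
  rw [mem_ball_zero_iff] at hx
  obtain ⟨ρ, h1, h2⟩ := exists_between hx
  have hρ0 : 0 ≤ ρ := (norm_nonneg x).trans h1.le
  have hs : Summable (fun n => ‖u n‖ * ρ ^ n) := by
    have := (hf (ρ : ℂ) (by simpa [abs_of_nonneg hρ0] using h2)).summable.norm
    simpa [abs_of_nonneg hρ0] using this
  have hd : ∀ n : ℕ, DifferentiableOn ℂ (fun w : ℂ => u n * w ^ n) (Metric.ball 0 ρ) := by
    intro n; fun_prop
  have hb : ∀ (n : ℕ) (w : ℂ), w ∈ Metric.ball (0 : ℂ) ρ → ‖u n * w ^ n‖ ≤ ‖u n‖ * ρ ^ n := by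
    intro n w hw
    rw [mem_ball_zero_iff] at hw
    rw [norm_mul, norm_pow]
    gcongr
  have hxm : x ∈ Metric.ball (0 : ℂ) ρ := by simpa using h1
  have heq : f =ᶠ[𝓝 x] fun w => ∑' n, u n * w ^ n := by
    filter_upwards [Metric.isOpen_ball.mem_nhds hxm] with w hw
    refine ((hf w ?_).tsum_eq).symm
    exact Metric.ball_subset_ball h2.le hw
  constructor
  · have := differentiableOn_tsum_of_summable_norm hs hd Metric.isOpen_ball hb
    exact ((this x hxm).differentiableAt (Metric.isOpen_ball.mem_nhds hxm)).congr_of_eventuallyEq heq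
  · have := (hasSum_deriv_of_summable_norm hs hd Metric.isOpen_ball hb hxm).mul_left x
    rw [heq.deriv_eq]
    have hfun : (fun n : ℕ => ((n : ℂ) * u n) * x ^ n) =
        fun n : ℕ => x * deriv (fun w => u n * w ^ n) x := by
      funext n
      rw [deriv_const_mul _ (by fun_prop), deriv_pow_field]
      rcases n with _ | n
      · simp
      · simp only [Nat.add_sub_cancel]; ring
    rw [hfun]
    exact this

/-- `f` solves the hypergeometric equation near zero, with first and second derivative
`f1`, `f2`. -/
def HypSol (A B c : ℂ) (f f1 f2 : ℂ → ℂ) : Prop :=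
  ∀ᶠ x in nhds (0 : ℂ), HasDerivAt f (f1 x) x ∧ HasDerivAt f1 (f2 x) x ∧
    x * (f1 x + x * f2 x) + (c - 1) * (x * f1 x)
      - x * (x * (f1 x + x * f2 x) + (A + B) * (x * f1 x) + A * B * f x) = 0

open Filter Topology in
theorem hyp_sum_aux (A B c : ℂ) : ∃ r : ℝ, 0 < r ∧ ∀ x ∈ Metric.ball (0 : ℂ) r,
    HasSum (fun n => ordinaryHypergeometricCoefficient A B c n * x ^ n)
      (ordinaryHypergeometric A B c x) := by
  have hr : 1 ≤ (ordinaryHypergeometricSeries ℂ A B c).radius := by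
    by_cases h : ∀ kn : ℕ, (kn : ℂ) ≠ -A ∧ (kn : ℂ) ≠ -B ∧ (kn : ℂ) ≠ -c
    · rw [ordinaryHypergeometricSeries_radius_eq_one ℂ A B c h]
    · push Not at h
      obtain ⟨k, hk⟩ := h
      by_cases h1 : (k : ℂ) = -A
      · have : A = -(k : ℂ) := by rw [h1]; ring
        rw [this, ordinaryHypergeometric_radius_top_of_neg_nat₁]; simp
      by_cases h2 : (k : ℂ) = -B
      · have : B = -(k : ℂ) := by rw [h2]; ring
        rw [this, ordinaryHypergeometric_radius_top_of_neg_nat₂]; simp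
      have : c = -(k : ℂ) := by rw [hk h1 h2]; ring
      rw [this, ordinaryHypergeometric_radius_top_of_neg_nat₃]; simp
  refine ⟨1, one_pos, fun x hx => ?_⟩
  have hx' : x ∈ Metric.eball (0 : ℂ) (ordinaryHypergeometricSeries ℂ A B c).radius := by
    refine Metric.eball_subset_eball hr ?_
    rw [← ENNReal.ofReal_one, Metric.eball_ofReal]
    exact hx
  have := (ordinaryHypergeometricSeries ℂ A B c).hasSum hx'
  simp only [ordinaryHypergeometricSeries_apply_eq, smul_eq_mul] at this
  exact this

open Filter Topology in
theorem hyp_sol (A B c : ℂ) (hc : ∀ n : ℕ, c ≠ -(n : ℂ)) :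
    HypSol A B c (ordinaryHypergeometric A B c) (deriv (ordinaryHypergeometric A B c))
      (deriv (deriv (ordinaryHypergeometric A B c))) := by
  obtain ⟨r, hr, hf⟩ := hyp_sum_aux A B c
  set f : ℂ → ℂ := ordinaryHypergeometric A B c
  set u := ordinaryHypergeometricCoefficient A B c with hu
  have h1 := hyp_theta_aux u f r hf
  have h2 := hyp_theta_aux _ (fun x => x * deriv f x) r (fun x hx => (h1 x hx).2)
  have hrec : ∀ n : ℕ, ((n : ℂ) + 1) * (n + c) * u (n + 1) = (n + A) * (n + B) * u n := by
    intro n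
    have hp : (ascPochhammer ℂ n).eval c ≠ 0 := by
      intro h
      obtain ⟨k, _, hk⟩ := (ascPochhammer_eval_eq_zero_iff _ _).1 h
      exact hc k (by rw [hk]; ring)
    have hcn : c + n ≠ 0 := fun h => hc n (by linear_combination h)
    have hn1 : (n : ℂ) + 1 ≠ 0 := by exact_mod_cast Nat.succ_ne_zero n
    have hn2 : (n.factorial : ℂ) ≠ 0 := by exact_mod_cast Nat.factorial_ne_zero n
    simp only [hu, ordinaryHypergeometricCoefficient, ascPochhammer_succ_eval, Nat.factorial_succ,
      Nat.cast_mul, Nat.cast_add, Nat.cast_one]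
    field_simp
    ring
  have hfd : DifferentiableOn ℂ f (Metric.ball 0 r) :=
    fun x hx => (h1 x hx).1.differentiableWithinAt
  have hfd1 := hfd.deriv Metric.isOpen_ball
  filter_upwards [Metric.ball_mem_nhds (0 : ℂ) hr] with x hx
  have hd1 : DifferentiableAt ℂ (deriv f) x :=
    (hfd1 x hx).differentiableAt (Metric.isOpen_ball.mem_nhds hx)
  refine ⟨(h1 x hx).1.hasDerivAt, hd1.hasDerivAt, ?_⟩
  have e : deriv (fun x => x * deriv f x) x = deriv f x + x * deriv (deriv f) x := by
    have := (hasDerivAt_id x).mul hd1.hasDerivAt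
    simp only [id, one_mul] at this
    exact this.deriv
  have s0 := hf x hx
  have s1 := (h1 x hx).2
  have s2 := (h2 x hx).2
  rw [e] at s2
  have L := s2.add (s1.mul_left (c - 1))
  have R := ((s2.add (s1.mul_left (A + B))).add (s0.mul_left (A * B))).mul_left x
  rw [← hasSum_nat_add_iff' 1] at L
  have hfun : (fun n : ℕ => (((n + 1 : ℕ) : ℂ) * (((n + 1 : ℕ) : ℂ) * u (n + 1))) * x ^ (n + 1)
        + (c - 1) * ((((n + 1 : ℕ) : ℂ) * u (n + 1)) * x ^ (n + 1))) =
      fun n : ℕ => x * (((n : ℂ) * ((n : ℂ) * u n)) * x ^ n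
        + (A + B) * (((n : ℂ) * u n) * x ^ n) + A * B * (u n * x ^ n)) := by
    funext n
    push_cast
    linear_combination (x ^ (n + 1)) * hrec n
  have := L.unique (hfun ▸ R)
  simp at this
  linear_combination this

open Filter Topology in
theorem theta_pow_aux (n : ℕ) (f f1 g : ℂ → ℂ) (hg : AnalyticAt ℂ g 0)
    (hf : ∀ᶠ x in 𝓝 (0 : ℂ), HasDerivAt f (f1 x) x)
    (hfg : ∀ᶠ x in 𝓝 (0 : ℂ), f x = x ^ n * g x) :
    ∀ᶠ x in 𝓝 (0 : ℂ), x * f1 x = x ^ n * (n * g x + x * deriv g x) := by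
  filter_upwards [hf, hfg.eventually_nhds, hg.eventually_analyticAt] with x h1 h2 h3
  have hd : HasDerivAt (fun x => x ^ n * g x)
      ((n : ℂ) * x ^ (n - 1) * g x + x ^ n * deriv g x) x :=
    (hasDerivAt_pow n x).mul h3.differentiableAt.hasDerivAt
  have := (h1.congr_of_eventuallyEq (EventuallyEq.symm h2)).unique hd
  rw [this]
  rcases n with _ | n
  · simp
  · simp only [Nat.add_sub_cancel]; ring

open Filter Topology in
theorem hyp_unique (A B c : ℂ) (hc : ∀ n : ℕ, c ≠ -(n : ℂ)) (f f1 f2 : ℂ → ℂ)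
    (h : HypSol A B c f f1 f2) (h0 : f 0 = 0) : ∀ᶠ x in 𝓝 (0 : ℂ), f x = 0 := by
  have han : AnalyticAt ℂ f 0 := by
    rw [Complex.analyticAt_iff_eventually_differentiableAt]
    filter_upwards [h] with x hx using hx.1.differentiableAt
  by_contra hne
  obtain ⟨n, g, hg, hg0, hfg⟩ := (han.exists_eventuallyEq_pow_smul_nonzero_iff).2 hne
  simp only [sub_zero, smul_eq_mul] at hfg
  have e1 := theta_pow_aux n f f1 g hg (h.mono fun x hx => hx.1) hfg
  have hP : AnalyticAt ℂ (fun x => (n : ℂ) * g x + x * deriv g x) 0 := by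
    have := hg.deriv
    fun_prop
  have e2 := theta_pow_aux n (fun x => x * f1 x) (fun x => f1 x + x * f2 x) _ hP
    (h.mono fun x hx => ((hasDerivAt_id x).mul hx.2.1).congr_deriv (by simp)) e1
  set P := fun x => (n : ℂ) * g x + x * deriv g x with hPdef
  have hK : ContinuousAt (fun x => ((n : ℂ) * P x + x * deriv P x) + (c - 1) * P x
      - x * (((n : ℂ) * P x + x * deriv P x) + (A + B) * P x + A * B * g x)) 0 := by
    have h1 := hP.continuousAt
    have h2 := hP.deriv.continuousAt
    have h3 := hg.continuousAt
    fun_prop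
  have hz : ∀ᶠ x in 𝓝[≠] (0 : ℂ), ((n : ℂ) * P x + x * deriv P x) + (c - 1) * P x
      - x * (((n : ℂ) * P x + x * deriv P x) + (A + B) * P x + A * B * g x) = 0 := by
    have hh := hfg.and (e1.and (e2.and h))
    filter_upwards [hh.filter_mono nhdsWithin_le_nhds, self_mem_nhdsWithin] with x hx hx0
    obtain ⟨a0, a1, a2, _, _, a3⟩ := hx
    have hxn : x ^ n ≠ 0 := pow_ne_zero _ hx0
    apply mul_left_cancel₀ hxn
    rw [a2, a1, a0] at a3
    linear_combination a3
  have hK0 := tendsto_nhds_unique (hK.tendsto.mono_left nhdsWithin_le_nhds)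
    (tendsto_const_nhds.congr' (EventuallyEq.symm hz))
  simp [hPdef] at hK0
  have h00 := hfg.self_of_nhds
  rcases n with _ | n
  · simp [h0] at h00
    exact hg0 h00.symm
  · have : ((n : ℂ) + 1) * (n + c) * g 0 = 0 := by
      push_cast at hK0
      linear_combination hK0
    rcases mul_eq_zero.1 this with h' | h'
    · rcases mul_eq_zero.1 h' with h'' | h''
      · exact absurd h'' (by exact_mod_cast Nat.succ_ne_zero n)
      · exact hc n (by linear_combination h'')
    · exact hg0 h'

theorem hyp_alg_aux (a x p y y1 y2 : ℂ) (hne : 4*x - 1 ≠ 0) :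
    x * ((p * (12 * a / (1 - 4*x) * y + -27 * (8*x+1) / (4*x-1)^4 * y1)) + x * (12 * a / (1 - 4*x) * p *
        (12 * a / (1 - 4*x) * y + -27 * (8*x+1) / (4*x-1)^4 * y1)
      + p * (48 * a / (1 - 4*x)^2 * y
        + 12 * a / (1 - 4*x) * (-27 * (8*x+1) / (4*x-1)^4 * y1)
        + 648 * (4*x+1) / (4*x-1)^5 * y1
        + -27 * (8*x+1) / (4*x-1)^4 * (-27 * (8*x+1) / (4*x-1)^4 * y2)))) + ((2*a+5/6) - 1) * (x * (p * (12 * a / (1 - 4*x) * y + -27 * (8*x+1) / (4*x-1)^4 * y1)))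
      - x * (x * ((p * (12 * a / (1 - 4*x) * y + -27 * (8*x+1) / (4*x-1)^4 * y1)) + x * (12 * a / (1 - 4*x) * p *
        (12 * a / (1 - 4*x) * y + -27 * (8*x+1) / (4*x-1)^4 * y1)
      + p * (48 * a / (1 - 4*x)^2 * y
        + 12 * a / (1 - 4*x) * (-27 * (8*x+1) / (4*x-1)^4 * y1)
        + 648 * (4*x+1) / (4*x-1)^5 * y1
        + -27 * (8*x+1) / (4*x-1)^4 * (-27 * (8*x+1) / (4*x-1)^4 * y2)))) + (3*a + (1/3 - a)) * (x * (p * (12 * a / (1 - 4*x) * y + -27 * (8*x+1) / (4*x-1)^4 * y1))) + 3*a * (1/3 - a) * (p * y))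
    = (-p * (4*x-1)) * ((27*x / (4*x - 1)^3) * (y1 + (27*x / (4*x - 1)^3) * y2) + ((2*a+5/6) - 1) * ((27*x / (4*x - 1)^3) * y1)
      - (27*x / (4*x - 1)^3) * ((27*x / (4*x - 1)^3) * (y1 + (27*x / (4*x - 1)^3) * y2) + (a + (a+1/3)) * ((27*x / (4*x - 1)^3) * y1) + a * (a+1/3) * y)) := by
  have e : 1 - 4*x = -(4*x-1) := by ring
  rw [e]
  obtain ⟨t, ht⟩ : ∃ t, t = 4*x - 1 := ⟨_, rfl⟩
  have hx' : x = (t+1)/4 := by rw [ht]; ring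
  have ht0 : t ≠ 0 := by rw [ht]; exact hne
  rw [← ht]
  clear ht e hne
  subst hx'
  field_simp
  ring

open Filter Topology in
theorem hyp_pullback (a : ℂ) (H H1 H2 : ℂ → ℂ)
    (h : HypSol a (a + 1/3) (2*a + 5/6) H H1 H2) :
    ∃ G1 G2, HypSol (3*a) (1/3 - a) (2*a + 5/6)
      (fun x => (1 - 4*x) ^ (-(3*a)) * H (27*x / (4*x - 1)^3)) G1 G2 := by
  refine ⟨fun x => (1 - 4*x) ^ (-(3*a)) * (12 * a / (1 - 4*x) * H (27*x / (4*x - 1)^3)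
      + -27 * (8*x+1) / (4*x-1)^4 * H1 (27*x / (4*x - 1)^3)),
    fun x => (12 * a / (1 - 4*x)) * (1 - 4*x) ^ (-(3*a)) *
        (12 * a / (1 - 4*x) * H (27*x / (4*x - 1)^3)
      + -27 * (8*x+1) / (4*x-1)^4 * H1 (27*x / (4*x - 1)^3))
      + (1 - 4*x) ^ (-(3*a)) * (48 * a / (1 - 4*x)^2 * H (27*x / (4*x - 1)^3)
        + 12 * a / (1 - 4*x) * (-27 * (8*x+1) / (4*x-1)^4 * H1 (27*x / (4*x - 1)^3))
        + 648 * (4*x+1) / (4*x-1)^5 * H1 (27*x / (4*x - 1)^3)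
        + -27 * (8*x+1) / (4*x-1)^4 * (-27 * (8*x+1) / (4*x-1)^4 * H2 (27*x / (4*x - 1)^3))), ?_⟩
  have hzc : Tendsto (fun x : ℂ => 27*x / (4*x - 1)^3) (𝓝 0) (𝓝 0) := by
    have : ContinuousAt (fun x : ℂ => 27*x / (4*x - 1)^3) 0 := by
      apply ContinuousAt.div
      · fun_prop
      · fun_prop
      · norm_num
    simpa using this.tendsto
  have hs : ∀ᶠ x in 𝓝 (0 : ℂ), 1 - 4*x ∈ slitPlane := by
    have : ContinuousAt (fun x : ℂ => 1 - 4*x) 0 := by fun_prop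
    apply this.eventually_mem
    apply isOpen_slitPlane.mem_nhds
    simp
  filter_upwards [hzc.eventually h, hs] with x hx hsx
  obtain ⟨k1, k2, k3⟩ := hx
  have hne : 1 - 4*x ≠ 0 := slitPlane_ne_zero hsx
  have hne' : 4*x - 1 ≠ 0 := fun hh => hne (by linear_combination -hh)
  have hl : HasDerivAt (fun x : ℂ => 1 - 4*x) (-4) x := by
    simpa using ((hasDerivAt_id x).const_mul 4).const_sub 1
  have hl' : HasDerivAt (fun x : ℂ => 4*x - 1) 4 x := by
    simpa using ((hasDerivAt_id x).const_mul 4).sub_const 1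
  have hp : HasDerivAt (fun x : ℂ => (1 - 4*x) ^ (-(3*a)))
      ((12 * a / (1 - 4*x)) * (1 - 4*x) ^ (-(3*a))) x := by
    refine HasDerivAt.congr_deriv (hl.cpow_const (c := -(3*a)) hsx) ?_
    rw [cpow_sub _ _ hne, cpow_one]
    field_simp
    ring
  have hz : HasDerivAt (fun x : ℂ => 27*x / (4*x - 1)^3) (-27 * (8*x+1) / (4*x-1)^4) x := by
    refine HasDerivAt.congr_deriv (((hasDerivAt_id x).const_mul 27).div (hl'.pow 3) (pow_ne_zero 3 hne')) ?_
    simp only [id]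
    field_simp
    norm_num
    ring
  have hz1 : HasDerivAt (fun x : ℂ => -27 * (8*x+1) / (4*x-1)^4) (648 * (4*x+1) / (4*x-1)^5) x := by
    have hm : HasDerivAt (fun x : ℂ => -27 * (8*x+1)) (-27 * 8) x := by
      simpa using (((hasDerivAt_id x).const_mul 8).add_const 1).const_mul (-27)
    refine HasDerivAt.congr_deriv (hm.div (hl'.pow 4) (pow_ne_zero 4 hne')) ?_
    field_simp
    norm_num
    ring
  have hq : HasDerivAt (fun x : ℂ => 12 * a / (1 - 4*x)) (48 * a / (1 - 4*x)^2) x := by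
    refine HasDerivAt.congr_deriv ((hasDerivAt_const x (12 * a)).div hl hne) ?_
    ring
  have hH : HasDerivAt (fun x => H (27*x / (4*x - 1)^3)) _ x := k1.comp x hz
  have hH1 : HasDerivAt (fun x => H1 (27*x / (4*x - 1)^3)) _ x := k2.comp x hz
  refine ⟨?_, ?_, ?_⟩
  · refine HasDerivAt.congr_deriv (hp.mul hH) ?_
    ring
  · refine HasDerivAt.congr_deriv (hp.mul ((hq.mul hH).add (hz1.mul hH1))) ?_
    ring
  · generalize hp' : (1 - 4*x) ^ (-(3*a)) = p
    generalize H (27*x / (4*x - 1)^3) = y at *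
    generalize H1 (27*x / (4*x - 1)^3) = y1 at *
    generalize H2 (27*x / (4*x - 1)^3) = y2 at *
    rw [hyp_alg_aux a x p y y1 y2 hne', k3, mul_zero]

theorem stmt2 (a : ℂ) (hc : ∀ n : ℕ, 2*a + 5/6 ≠ -(n : ℂ)) :
    ∃ U : Set ℂ, IsOpen U ∧ (0 : ℂ) ∈ U ∧ ∀ x ∈ U,
      ordinaryHypergeometric (3*a) (1/3 - a) (2*a + 5/6) x =
        (1 - 4*x) ^ (-(3*a)) * ordinaryHypergeometric a (a + 1/3) (2*a + 5/6) (27*x / (4*x - 1)^3) := by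
  have hF := hyp_sol (3*a) (1/3 - a) (2*a + 5/6) hc
  obtain ⟨G1, G2, hG⟩ := hyp_pullback a _ _ _ (hyp_sol a (a + 1/3) (2*a + 5/6) hc)
  have hD : HypSol (3*a) (1/3 - a) (2*a + 5/6)
      (fun x => ordinaryHypergeometric (3*a) (1/3 - a) (2*a + 5/6) x -
        (1 - 4*x) ^ (-(3*a)) * ordinaryHypergeometric a (a + 1/3) (2*a + 5/6) (27*x / (4*x - 1)^3))
      (fun x => deriv (ordinaryHypergeometric (3*a) (1/3 - a) (2*a + 5/6)) x - G1 x)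
      (fun x => deriv (deriv (ordinaryHypergeometric (3*a) (1/3 - a) (2*a + 5/6))) x - G2 x) := by
    filter_upwards [hF, hG] with x h1 h2
    refine ⟨h1.1.sub h2.1, h1.2.1.sub h2.2.1, ?_⟩
    linear_combination h1.2.2 - h2.2.2
  have := hyp_unique _ _ _ hc _ _ _ hD (by simp)
  obtain ⟨U, hU, hUo, h0⟩ := eventually_nhds_iff.1 this
  exact ⟨U, hUo, h0, fun x hx => sub_eq_zero.1 (hU x hx)⟩
end

section
/- Let a, q, t ∈ ℂ with t ∉ {0, 1}. Suppose y : ℂ → ℂ is analytic on an open neighborhood V of 0 and satisfies Heun's differential equation with parameters (t, q; a, a+1/2; 2a+1/2; 1/2) at every z ∈ V with z ∉ {0, 1, t}. Then there is an open neighborhood U of 0 such that the function g(x) = (1 - x²/t)^(-2a) · y(4tx(x-1)(x-t)/(x²-t)²) satisfies Heun's differential equation with parameters (t, 4q; 4a, 2a+1/2; 2a+1/2; 2a+1/2) at every x ∈ U with x ∉ {0, 1, t}. -/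
open Complex

/-- `g` satisfies Heun's differential equation with parameters `(t, q; a, b; c; d)`
at the point `x`: `g` is twice complex differentiable at `x` and
`g''(x) + (c/x + d/(x-1) + (a+b-c-d+1)/(x-t)) g'(x) + ((a b x - q)/(x(x-1)(x-t))) g(x) = 0`. -/
def SatisfiesHeunAt (t q a b c d : ℂ) (g : ℂ → ℂ) (x : ℂ) : Prop :=
  DifferentiableAt ℂ g x ∧ DifferentiableAt ℂ (deriv g) x ∧
    deriv (deriv g) x +
      (c / x + d / (x - 1) + (a + b - c - d + 1) / (x - t)) * deriv g x +
      ((a * b * x - q) / (x * (x - 1) * (x - t))) * g x = 0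

open Filter Topology

lemma heun_R_hasDeriv (t x : ℂ) (hA : x^2 - t ≠ 0) :
    HasDerivAt (fun x : ℂ => 4*t*x*(x-1)*(x-t)/(x^2-t)^2)
      (-(4*t*(x^2-2*x+t)*(x^2-2*t*x+t))/(x^2-t)^3) x := by
  have hid := hasDerivAt_id' x
  have h1 := (((hid.const_mul (4*t)).mul (hid.sub_const 1)).mul (hid.sub_const t)).div
    (((hid.pow 2).sub_const t).pow 2) (pow_ne_zero 2 hA)
  refine HasDerivAt.congr_deriv (f := fun x : ℂ => 4*t*x*(x-1)*(x-t)/(x^2-t)^2) h1 ?_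
  simp only [Pi.mul_apply, Pi.pow_apply]
  field_simp
  push_cast
  ring

lemma heun_R1_hasDeriv (t x : ℂ) (hA : x^2 - t ≠ 0) :
    HasDerivAt (fun x : ℂ => -(4*t*(x^2-2*x+t)*(x^2-2*t*x+t))/(x^2-t)^3)
      (-(4*t)*(((2*x-2)*(x^2-2*t*x+t)+(x^2-2*x+t)*(2*x-2*t))*(x^2-t)
        - (x^2-2*x+t)*(x^2-2*t*x+t)*(6*x))/(x^2-t)^4) x := by
  have hid := hasDerivAt_id' x
  have h1 := (((((((hid.pow 2).sub (hid.const_mul 2)).add_const t).const_mul (4*t)).mul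
    (((hid.pow 2).sub (hid.const_mul (2*t))).add_const t)).neg).div
    (((hid.pow 2).sub_const t).pow 3) (pow_ne_zero 3 hA))
  refine HasDerivAt.congr_deriv
    (f := fun x : ℂ => -(4*t*(x^2-2*x+t)*(x^2-2*t*x+t))/(x^2-t)^3) h1 ?_
  simp only [Pi.mul_apply, Pi.pow_apply, Pi.sub_apply, Pi.neg_apply]
  field_simp
  push_cast
  ring

lemma heun_L_hasDeriv (a t x : ℂ) (hA : x^2 - t ≠ 0) :
    HasDerivAt (fun x : ℂ => -(4*a*x)/(x^2-t)) (4*a*(x^2+t)/(x^2-t)^2) x := by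
  have hid := hasDerivAt_id' x
  have h1 := ((hid.const_mul (4*a)).neg).div ((hid.pow 2).sub_const t) hA
  refine HasDerivAt.congr_deriv (f := fun x : ℂ => -(4*a*x)/(x^2-t)) h1 ?_
  simp only [Pi.pow_apply, Pi.neg_apply]
  field_simp
  push_cast
  ring

lemma heun_P_hasDeriv (a t x : ℂ) (ht0 : t ≠ 0) (hA : x^2 - t ≠ 0)
    (hs : 1 - x^2/t ∈ slitPlane) :
    HasDerivAt (fun x : ℂ => (1 - x^2/t) ^ (-(2*a)))
      ((1 - x^2/t) ^ (-(2*a)) * (-(4*a*x)/(x^2-t))) x := by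
  have hid := hasDerivAt_id' x
  have h0 : HasDerivAt (fun x : ℂ => 1 - x^2/t) (-(2*x/t)) x := by
    refine HasDerivAt.congr_deriv (((hid.pow 2).div_const t).const_sub 1) ?_
    simp
  have h1 := h0.cpow_const (c := -(2*a)) hs
  refine h1.congr_deriv ?_
  rw [Complex.cpow_sub _ _ (slitPlane_ne_zero hs), Complex.cpow_one]
  have h2 : 1 - x^2/t = -(x^2-t)/t := by field_simp; ring
  have h3 : (1 - x^2/t) ≠ 0 := slitPlane_ne_zero hs
  generalize (1 - x^2/t) ^ (-(2*a)) = p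
  rw [h2]
  field_simp
  ring

lemma heun_id1 (a t x : ℂ) (ht0 : t ≠ 0) (hx0 : x ≠ 0) (hx1 : x - 1 ≠ 0) (hxt : x - t ≠ 0)
    (hA : x^2 - t ≠ 0) (hB : x^2-2*x+t ≠ 0) (hC : x^2-2*t*x+t ≠ 0)
    (R R1 R2 L : ℂ)
    (hR : R = 4*t*x*(x-1)*(x-t)/(x^2-t)^2)
    (hR1' : R - 1 = -(x^2-2*t*x+t)^2/(x^2-t)^2)
    (hRt' : R - t = -t*(x^2-2*x+t)^2/(x^2-t)^2)
    (hR1 : R1 = -(4*t*(x^2-2*x+t)*(x^2-2*t*x+t))/(x^2-t)^3)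
    (hR2 : R2 = (-(4*t)*(((2*x-2)*(x^2-2*t*x+t)+(x^2-2*x+t)*(2*x-2*t))*(x^2-t)
        - (x^2-2*x+t)*(x^2-2*t*x+t)*(6*x))/(x^2-t)^4))
    (hL : L = -(4*a*x)/(x^2-t)) :
    2*L*R1 + R2 + ((2*a+1/2)/x + (2*a+1/2)/(x-1) +
      (4*a+(2*a+1/2)-(2*a+1/2)-(2*a+1/2)+1)/(x-t))*R1
      = R1^2*((2*a+1/2)/R + (1/2)/(R-1) + (a+(a+1/2)-(2*a+1/2)-1/2+1)/(R-t)) := by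
  rw [hR1', hRt', hR, hR1, hR2, hL]
  generalize hAe : x^2-t = A at *
  generalize hBe : x^2-2*x+t = B at *
  generalize hCe : x^2-2*t*x+t = C at *
  generalize hDe : x - 1 = D at *
  generalize hEe : x - t = E at *
  field_simp
  subst hAe hBe hCe hDe hEe
  ring

lemma heun_id2 (a q t x : ℂ) (ht0 : t ≠ 0) (hx0 : x ≠ 0) (hx1 : x - 1 ≠ 0) (hxt : x - t ≠ 0)
    (hA : x^2 - t ≠ 0) (hB : x^2-2*x+t ≠ 0) (hC : x^2-2*t*x+t ≠ 0)
    (R R1 L L1 : ℂ)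
    (hR : R = 4*t*x*(x-1)*(x-t)/(x^2-t)^2)
    (hR1' : R - 1 = -(x^2-2*t*x+t)^2/(x^2-t)^2)
    (hRt' : R - t = -t*(x^2-2*x+t)^2/(x^2-t)^2)
    (hR1 : R1 = -(4*t*(x^2-2*x+t)*(x^2-2*t*x+t))/(x^2-t)^3)
    (hL : L = -(4*a*x)/(x^2-t))
    (hL1 : L1 = 4*a*(x^2+t)/(x^2-t)^2) :
    L^2 + L1 + ((2*a+1/2)/x + (2*a+1/2)/(x-1) +
      (4*a+(2*a+1/2)-(2*a+1/2)-(2*a+1/2)+1)/(x-t))*L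
      + (4*a*(2*a+1/2)*x-4*q)/(x*(x-1)*(x-t))
      = R1^2*((a*(a+1/2)*R-q)/(R*(R-1)*(R-t))) := by
  rw [hR1', hRt', hR, hR1, hL, hL1]
  generalize hAe : x^2-t = A at *
  generalize hBe : x^2-2*x+t = B at *
  generalize hCe : x^2-2*t*x+t = C at *
  generalize hDe : x - 1 = D at *
  generalize hEe : x - t = E at *
  field_simp
  subst hAe hBe hCe hDe hEe
  ring

theorem stmt8 (a q t : ℂ) (ht0 : t ≠ 0) (ht1 : t ≠ 1)
    (y : ℂ → ℂ) (V : Set ℂ) (hV : IsOpen V) (h0V : (0 : ℂ) ∈ V)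
    (hya : AnalyticOnNhd ℂ y V)
    (hy : ∀ z ∈ V, z ≠ 0 → z ≠ 1 → z ≠ t →
      SatisfiesHeunAt t q a (a + 1/2) (2*a + 1/2) (1/2) y z) :
    ∃ U : Set ℂ, IsOpen U ∧ (0 : ℂ) ∈ U ∧ ∀ x ∈ U,
      x ≠ 0 → x ≠ 1 → x ≠ t →
      SatisfiesHeunAt t (4*q) (4*a) (2*a + 1/2) (2*a + 1/2) (2*a + 1/2)
        (fun x : ℂ => (1 - x^2/t) ^ (-(2*a)) * y (4*t*x*(x-1)*(x-t)/(x^2-t)^2)) x := by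
  have hev : ∀ᶠ x : ℂ in 𝓝 0, (4*t*x*(x-1)*(x-t)/(x^2-t)^2 ∈ V ∧ 1 - x^2/t ∈ slitPlane) ∧
      x^2 - t ≠ 0 ∧ x^2-2*x+t ≠ 0 ∧ x^2-2*t*x+t ≠ 0 := by
    refine Eventually.and (Eventually.and ?_ ?_) (Eventually.and ?_ (Eventually.and ?_ ?_))
    · have hc := (heun_R_hasDeriv t 0 (by simpa using ht0)).continuousAt
      exact hc.eventually_mem (by simpa using hV.mem_nhds h0V)
    · have hc : ContinuousAt (fun x : ℂ => 1 - x^2/t) 0 := by fun_prop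
      exact hc.eventually_mem (isOpen_slitPlane.mem_nhds (by simp))
    · have hc : ContinuousAt (fun x : ℂ => x^2 - t) 0 := by fun_prop
      exact hc.eventually_ne (by simpa using ht0)
    · have hc : ContinuousAt (fun x : ℂ => x^2-2*x+t) 0 := by fun_prop
      exact hc.eventually_ne (by simpa using ht0)
    · have hc : ContinuousAt (fun x : ℂ => x^2-2*t*x+t) 0 := by fun_prop
      exact hc.eventually_ne (by simpa using ht0)
  obtain ⟨U, hU, hUo, h0U⟩ := eventually_nhds_iff.1 hev
  refine ⟨U, hUo, h0U, fun x hxU hx0 hx1 hxt => ?_⟩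
  -- first derivative of g on all of U
  have hg1 : ∀ x ∈ U, HasDerivAt
      (fun x : ℂ => (1 - x^2/t) ^ (-(2*a)) * y (4*t*x*(x-1)*(x-t)/(x^2-t)^2))
      ((1 - x^2/t) ^ (-(2*a)) * ((-(4*a*x)/(x^2-t)) * y (4*t*x*(x-1)*(x-t)/(x^2-t)^2) +
        (-(4*t*(x^2-2*x+t)*(x^2-2*t*x+t))/(x^2-t)^3) *
          deriv y (4*t*x*(x-1)*(x-t)/(x^2-t)^2))) x := by
    intro x hx
    obtain ⟨⟨hRV, hs⟩, hA, -, -⟩ := hU x hx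
    have hyR := ((hya _ hRV).differentiableAt.hasDerivAt).comp x (heun_R_hasDeriv t x hA)
    refine ((heun_P_hasDeriv a t x ht0 hA hs).mul hyR).congr_deriv ?_
    simp only [Function.comp]
    ring
  obtain ⟨⟨hRV, hs⟩, hA, hB, hC⟩ := hU x hxU
  have hR1' : 4*t*x*(x-1)*(x-t)/(x^2-t)^2 - 1 = -(x^2-2*t*x+t)^2/(x^2-t)^2 := by
    field_simp; ring
  have hRt' : 4*t*x*(x-1)*(x-t)/(x^2-t)^2 - t = -t*(x^2-2*x+t)^2/(x^2-t)^2 := by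
    field_simp; ring
  have hx1' := sub_ne_zero.2 hx1
  have hxt' := sub_ne_zero.2 hxt
  have hy2 := ((hya _ hRV).deriv.differentiableAt.hasDerivAt).comp x (heun_R_hasDeriv t x hA)
  have hy1 := ((hya _ hRV).differentiableAt.hasDerivAt).comp x (heun_R_hasDeriv t x hA)
  have hg2 := (heun_P_hasDeriv a t x ht0 hA hs).mul
    (((heun_L_hasDeriv a t x hA).mul hy1).add ((heun_R1_hasDeriv t x hA).mul hy2))
  have heq : deriv (fun x : ℂ => (1 - x^2/t) ^ (-(2*a)) * y (4*t*x*(x-1)*(x-t)/(x^2-t)^2))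
      =ᶠ[𝓝 x] _ := (hUo.eventually_mem hxU).mono fun z hz => (hg1 z hz).deriv
  have hg2' := HasDerivAt.congr_of_eventuallyEq hg2 heq
  have hODE := (hy _ hRV
    (div_ne_zero (by simp [ht0, hx0, hx1', hxt']) (pow_ne_zero 2 hA))
    (sub_ne_zero.1 (by rw [hR1']; exact div_ne_zero (neg_ne_zero.2 (pow_ne_zero 2 hC)) (pow_ne_zero 2 hA)))
    (sub_ne_zero.1 (by
      rw [hRt']
      exact div_ne_zero (mul_ne_zero (neg_ne_zero.2 ht0) (pow_ne_zero 2 hB)) (pow_ne_zero 2 hA)))).2.2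
  refine ⟨(hg1 x hxU).differentiableAt, hg2'.differentiableAt, ?_⟩
  rw [hg2'.deriv, (hg1 x hxU).deriv]
  have e1 := heun_id1 a t x ht0 hx0 hx1' hxt' hA hB hC _ _ _ _ rfl hR1' hRt' rfl rfl rfl
  have e2 := heun_id2 a q t x ht0 hx0 hx1' hxt' hA hB hC _ _ _ _ rfl hR1' hRt' rfl rfl rfl
  simp only [Pi.mul_apply, Pi.add_apply, Function.comp]
  clear hg2' heq hg2 hy1 hy2 hg1 hR1' hRt'
  generalize 4*t*x*(x-1)*(x-t)/(x^2-t)^2 = R at *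
  generalize -(4*t*(x^2-2*x+t)*(x^2-2*t*x+t))/(x^2-t)^3 = R1 at *
  generalize (-(4*t)*(((2*x-2)*(x^2-2*t*x+t)+(x^2-2*x+t)*(2*x-2*t))*(x^2-t)
        - (x^2-2*x+t)*(x^2-2*t*x+t)*(6*x))/(x^2-t)^4) = R2 at *
  generalize -(4*a*x)/(x^2-t) = L at *
  generalize 4*a*(x^2+t)/(x^2-t)^2 = L1 at *
  generalize (1 - x^2/t) ^ (-(2*a)) = P at *
  generalize ((2*a+1/2)/x + (2*a+1/2)/(x-1) +
      (4*a+(2*a+1/2)-(2*a+1/2)-(2*a+1/2)+1)/(x-t)) = p at *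
  generalize (4*a*(2*a+1/2)*x-4*q)/(x*(x-1)*(x-t)) = r at *
  generalize ((2*a+1/2)/R + (1/2)/(R-1) + (a+(a+1/2)-(2*a+1/2)-1/2+1)/(R-t)) = pR at *
  generalize (a*(a+1/2)*R-q)/(R*(R-1)*(R-t)) = rR at *
  linear_combination P * R1^2 * hODE + P * deriv y R * e1 + P * y R * e2
end

section
/- Let a, b ∈ ℂ with a + b + 1/2 not a nonpositive integer. Then there is an open neighborhood U of 0 in ℂ such that the function g(x) = (1 - 3x/4)^(-2a) · ₂F₁(a, b; a+b+1/2; x³/(4-3x)²) satisfies Heun's differential equation with parameters (t, q; a', b'; c'; d') = (4/3, 6a² + 6ab - a; 3a, 2a+b; 3a+3b-1/2; 1/2) at every x ∈ U with x ∉ {0, 1, 4/3}. -/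
open Complex

lemma alg_final (a b x P F F1 F2 : ℂ) (hw : 4-3*x ≠ 0) (hx : x ≠ 0) (h1 : x-1 ≠ 0)
    (ode : x^3/(4-3*x)^2*(1-x^3/(4-3*x)^2)*F2
      + (a+b+1/2-(a+b+1)*(x^3/(4-3*x)^2))*F1 - a*b*F = 0) :
    P * ((6*a/(4-3*x)) * ((6*a/(4-3*x)) * F + (12*x^2-3*x^3)/(4-3*x)^3*F1) +
      ((18*a/(4-3*x)^2) * F + (6*a/(4-3*x)) * ((12*x^2-3*x^3)/(4-3*x)^3*F1) +
      (((24*x - 9*x^2)*(4-3*x) + 9*(12*x^2-3*x^3))/(4-3*x)^4 *F1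
        + (12*x^2-3*x^3)/(4-3*x)^3*((12*x^2-3*x^3)/(4-3*x)^3*F2))))
    + ((3*a + 3*b - 1/2) / x + (1/2) / (x - 1)
        + (3*a + (2*a+b) - (3*a + 3*b - 1/2) - 1/2 + 1) / (x - 4/3))
      * (P * ((6*a/(4-3*x)) * F + (12*x^2-3*x^3)/(4-3*x)^3*F1)) +
      ((3*a * (2*a+b) * x - (6*a^2 + 6*a*b - a)) / (x * (x - 1) * (x - 4/3))) * (P*F) = 0 := by
  have e : x - 4/3 = -(4-3*x)/3 := by ring
  rw [e]
  obtain ⟨w, hwd⟩ : ∃ w, w = 4 - 3*x := ⟨_, rfl⟩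
  obtain ⟨s, hsd⟩ : ∃ s, s = x - 1 := ⟨_, rfl⟩
  rw [← hwd] at hw ode ⊢
  rw [← hsd] at h1 ⊢
  have hF : (6*a/w)*(6*a/w) + 18*a/w^2 + ((3*a + 3*b - 1/2) / x + (1/2) / s
        + (3*a + (2*a+b) - (3*a + 3*b - 1/2) - 1/2 + 1) / (-w/3)) * (6*a/w)
        + (3*a * (2*a+b) * x - (6*a^2 + 6*a*b - a)) / (x * s * (-w/3))
        = 9*x/(w^2*s) * (a*b) := by
    field_simp
    subst hwd hsd
    ring
  have hF1 : 2*((6*a/w)*((12*x^2-3*x^3)/w^3)) + ((24*x - 9*x^2)*w + 9*(12*x^2-3*x^3))/w^4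
        + ((3*a + 3*b - 1/2) / x + (1/2) / s
        + (3*a + (2*a+b) - (3*a + 3*b - 1/2) - 1/2 + 1) / (-w/3)) * ((12*x^2-3*x^3)/w^3)
        = -(9*x/(w^2*s)) * (a+b+1/2-(a+b+1)*(x^3/w^2)) := by
    field_simp
    subst hwd hsd
    ring
  have hF2 : ((12*x^2-3*x^3)/w^3)*((12*x^2-3*x^3)/w^3)
        = -(9*x/(w^2*s)) * (x^3/w^2*(1-x^3/w^2)) := by
    field_simp
    subst hwd hsd
    ring
  linear_combination P*F*hF + P*F1*hF1 + P*F2*hF2 - P*(9*x/(w^2*s))*ode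

lemma hasSum_shift {f : ℕ → ℂ} {s : ℂ} (h0 : f 0 = 0) (h : HasSum (fun n => f (n+1)) s) :
    HasSum f s := by
  have := (hasSum_nat_add_iff (f := f) 1).1 h
  simpa [h0] using this

lemma hasSum_of_eq {f g : ℕ → ℂ} {s : ℂ} (h : HasSum f s) (e : ∀ n, g n = f n) :
    HasSum g s := by
  rwa [show g = f from funext e]

lemma coef_rec (a b c : ℂ) (hc : ∀ n : ℕ, c ≠ -(n : ℂ)) (n : ℕ) :
    ((n:ℂ)+1)*(c+n)*ordinaryHypergeometricCoefficient a b c (n+1)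
      = (a+n)*(b+n)*ordinaryHypergeometricCoefficient a b c n := by
  have h1 : (n:ℂ)+1 ≠ 0 := Nat.cast_add_one_ne_zero n
  have h2 : c + n ≠ 0 := by
    intro h; exact hc n (by linear_combination h)
  simp only [ordinaryHypergeometricCoefficient, ascPochhammer_succ_eval, Nat.factorial_succ,
    Nat.cast_mul, Nat.cast_add, Nat.cast_one, mul_inv]
  field_simp

lemma radius_ge (a b c : ℂ) (hc : ∀ n : ℕ, c ≠ -(n : ℂ)) :
    1 ≤ (ordinaryHypergeometricSeries ℂ a b c).radius := by
  by_cases h : ∀ kn : ℕ, (kn:ℂ) ≠ -a ∧ (kn:ℂ) ≠ -b ∧ (kn:ℂ) ≠ -c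
  · rw [ordinaryHypergeometricSeries_radius_eq_one ℂ a b c h]
  · push Not at h
    obtain ⟨k, hk⟩ := h
    by_cases ha : (k:ℂ) = -a
    · have : a = -(k:ℂ) := by rw [ha]; ring
      rw [this, ordinaryHypergeometric_radius_top_of_neg_nat₁]; exact le_top
    by_cases hb : (k:ℂ) = -b
    · have : b = -(k:ℂ) := by rw [hb]; ring
      rw [this, ordinaryHypergeometric_radius_top_of_neg_nat₂]; exact le_top
    · exact absurd (by rw [hk ha hb]; ring) (hc k)

lemma hyp_fps (a b c : ℂ) (hc : ∀ n : ℕ, c ≠ -(n : ℂ)) :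
    HasFPowerSeriesOnBall (ordinaryHypergeometric a b c : ℂ → ℂ)
      (ordinaryHypergeometricSeries ℂ a b c) 0 1 := by
  have h := (ordinaryHypergeometricSeries ℂ a b c).hasFPowerSeriesOnBall
    (lt_of_lt_of_le zero_lt_one (radius_ge a b c hc))
  exact h.mono zero_lt_one (radius_ge a b c hc)

lemma hyp_ode_s13 (a b c : ℂ) (hc : ∀ n : ℕ, c ≠ -(n : ℂ)) :
    let F : ℂ → ℂ := ordinaryHypergeometric a b c
    ∀ z : ℂ, ‖z‖ < 1 → DifferentiableAt ℂ F z ∧ DifferentiableAt ℂ (deriv F) z ∧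
      z*(1-z)*deriv (deriv F) z + (c-(a+b+1)*z)*deriv F z - a*b*F z = 0 := by
  intro F z hz
  have hp := hyp_fps a b c hc
  have hball : Metric.eball (0:ℂ) 1 = Metric.ball (0:ℂ) 1 := by
    simpa using (Metric.eball_ofReal (x := (0:ℂ)) (ε := 1))
  have d0 : DifferentiableOn ℂ F (Metric.ball 0 1) := by
    rw [← hball]; exact hp.differentiableOn
  have d1 : DifferentiableOn ℂ (deriv F) (Metric.ball 0 1) := d0.deriv Metric.isOpen_ball
  have d2 : DifferentiableOn ℂ (deriv (deriv F)) (Metric.ball 0 1) := d1.deriv Metric.isOpen_ball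
  have hzb : z ∈ Metric.ball (0:ℂ) 1 := by simpa using hz
  have hnh := Metric.isOpen_ball.mem_nhds hzb
  refine ⟨d0.differentiableAt hnh, d1.differentiableAt hnh, ?_⟩
  set u : ℕ → ℂ := ordinaryHypergeometricCoefficient a b c with hu
  have hcoef : ∀ n, iteratedDeriv n F 0 = (n.factorial : ℂ) * u n := by
    intro n
    have := hp.factorial_smul (1:ℂ) n
    rw [iteratedDeriv_eq_iteratedFDeriv, ← this, ordinaryHypergeometricSeries_apply_eq]
    simp [hu]
  have s0 := Complex.hasSum_taylorSeries_on_ball d0 hzb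
  have s1 := Complex.hasSum_taylorSeries_on_ball d1 hzb
  have s2 := Complex.hasSum_taylorSeries_on_ball d2 hzb
  simp only [← iteratedDeriv_succ', hcoef, sub_zero, smul_eq_mul] at s0 s1 s2
  have hf : ∀ n : ℕ, (n.factorial : ℂ) ≠ 0 := fun n => Nat.cast_ne_zero.2 n.factorial_ne_zero
  have t0 : HasSum (fun n => u n * z^n) (F z) := by
    refine hasSum_of_eq s0 fun n => ?_
    have := hf n
    field_simp
  have t1 : HasSum (fun n : ℕ => ((n:ℂ)+1) * u (n+1) * z^n) (deriv F z) := by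
    refine hasSum_of_eq s1 fun n => ?_
    have := hf n
    rw [Nat.factorial_succ]; push_cast
    field_simp
  have t2 : HasSum (fun n : ℕ => ((n:ℂ)+1) * ((n:ℂ)+2) * u (n+2) * z^n) (deriv (deriv F) z) := by
    refine hasSum_of_eq s2 fun n => ?_
    have := hf n
    rw [Nat.factorial_succ, Nat.factorial_succ]; push_cast
    field_simp
    ring
  have r1 : HasSum (fun n : ℕ => (n:ℂ) * u n * z^n) (z * deriv F z) := by
    apply hasSum_shift (by simp)
    refine hasSum_of_eq (t1.mul_left z) fun n => ?_
    push_cast; ring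
  have r2 : HasSum (fun n : ℕ => (n:ℂ) * ((n:ℂ)+1) * u (n+1) * z^n)
      (z * deriv (deriv F) z) := by
    apply hasSum_shift (by simp)
    refine hasSum_of_eq (t2.mul_left z) fun n => ?_
    push_cast; ring
  have r3 : HasSum (fun n : ℕ => (n:ℂ) * ((n:ℂ)-1) * u n * z^n)
      (z * (z * deriv (deriv F) z)) := by
    apply hasSum_shift (by simp)
    refine hasSum_of_eq (r2.mul_left z) fun n => ?_
    push_cast; ring
  have tot := (((r2.sub r3).add (t1.mul_left c)).sub (r1.mul_left (a+b+1))).sub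
    (t0.mul_left (a*b))
  have hz0 : HasSum (fun _ : ℕ => (0:ℂ)) 0 := hasSum_zero
  have key := tot.unique (hasSum_of_eq hz0 fun n => by
    have := coef_rec a b c hc n
    linear_combination z^n * this)
  linear_combination key

lemma deriv_P (a x : ℂ) (hx : ‖x‖ < 1/2) :
    HasDerivAt (fun x : ℂ => (1 - 3*x/4) ^ (-(2*a)))
      ((1 - 3*x/4) ^ (-(2*a)) * (6*a/(4-3*x))) x := by
  have hre : |x.re| ≤ ‖x‖ := Complex.abs_re_le_norm x
  have hpos : 0 < (1 - 3*x/4).re := by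
    have : (1 - 3*x/4).re = 1 - 3*x.re/4 := by simp
    rw [this]
    have := abs_le.1 hre
    linarith
  have hs : (1 - 3*x/4) ∈ Complex.slitPlane := Or.inl hpos
  have hne : (1 - 3*x/4) ≠ 0 := Complex.slitPlane_ne_zero hs
  have hne' : 4 - 3*x ≠ 0 := by intro h; apply hne; linear_combination h/4
  have hd : HasDerivAt (fun x : ℂ => 1 - 3*x/4) (-(3/4)) x := by
    refine HasDerivAt.congr_deriv ((((hasDerivAt_id x).const_mul 3).div_const 4).const_sub 1) ?_
    norm_num
  refine HasDerivAt.congr_deriv (hd.cpow_const (c := -(2*a)) hs) ?_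
  rw [Complex.cpow_sub _ _ hne, Complex.cpow_one]
  have : 4 - 3*x = 4 * (1-3*x/4) := by ring
  rw [this]
  field_simp
  ring

theorem stmt13 (a b : ℂ) (hc : ∀ n : ℕ, a + b + 1/2 ≠ -(n : ℂ)) :
    ∃ U : Set ℂ, IsOpen U ∧ (0 : ℂ) ∈ U ∧ ∀ x ∈ U, x ≠ (0 : ℂ) → x ≠ (1 : ℂ) → x ≠ (4/3 : ℂ) →
      SatisfiesHeunAt (4/3) (6*a^2 + 6*a*b - a) (3*a) (2*a + b) (3*a + 3*b - 1/2) (1/2)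
        (fun x : ℂ => (1 - 3*x/4) ^ (-(2*a)) * ordinaryHypergeometric a b (a + b + 1/2) (x^3 / (4 - 3*x)^2)) x := by
  let F : ℂ → ℂ := ordinaryHypergeometric a b (a+b+1/2)
  have hode := hyp_ode_s13 a b _ hc
  set P : ℂ → ℂ := fun x : ℂ => (1 - 3*x/4) ^ (-(2*a)) with hP
  have hw : ∀ x : ℂ, ‖x‖ < 1/2 → 5/2 ≤ ‖4-3*x‖ := by
    intro x hx
    have := norm_sub_norm_le (4:ℂ) (3*x)
    simp at this
    linarith
  have hw0 : ∀ x : ℂ, ‖x‖ < 1/2 → 4-3*x ≠ 0 := by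
    intro x hx h
    have := hw x hx
    rw [h] at this; norm_num at this
  have hzl : ∀ x : ℂ, ‖x‖ < 1/2 → ‖x^3/(4-3*x)^2‖ < 1 := by
    intro x hx
    have h1 := hw x hx
    rw [norm_div, norm_pow, norm_pow, div_lt_one (by positivity)]
    have h2 : ‖x‖^3 ≤ (1/2)^3 := pow_le_pow_left₀ (norm_nonneg _) hx.le 3
    nlinarith
  have hwd : ∀ x : ℂ, HasDerivAt (fun x : ℂ => 4-3*x) (-3) x := by
    intro x
    refine HasDerivAt.congr_deriv (((hasDerivAt_id x).const_mul 3).const_sub 4) ?_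
    norm_num
  have hzd : ∀ x : ℂ, ‖x‖ < 1/2 → HasDerivAt (fun x : ℂ => x^3/(4-3*x)^2)
      ((12*x^2-3*x^3)/(4-3*x)^3) x := by
    intro x hx
    have := hw0 x hx
    refine HasDerivAt.congr_deriv ((hasDerivAt_pow 3 x).div ((hwd x).pow 2) (pow_ne_zero 2 this)) ?_
    field_simp
    push_cast
    ring
  have hzdd : ∀ x : ℂ, ‖x‖ < 1/2 → HasDerivAt (fun x : ℂ => (12*x^2-3*x^3)/(4-3*x)^3)
      (((24*x - 9*x^2)*(4-3*x) + 9*(12*x^2-3*x^3))/(4-3*x)^4) x := by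
    intro x hx
    have := hw0 x hx
    refine HasDerivAt.congr_deriv ((((hasDerivAt_pow 2 x).const_mul 12).sub ((hasDerivAt_pow 3 x).const_mul 3)).div
      ((hwd x).pow 3) (pow_ne_zero 3 this)) ?_
    simp only [Pi.sub_apply]
    field_simp
    push_cast
    ring
  have hQd : ∀ x : ℂ, ‖x‖ < 1/2 → HasDerivAt (fun x : ℂ => 6*a/(4-3*x))
      (18*a/(4-3*x)^2) x := by
    intro x hx
    have := hw0 x hx
    refine HasDerivAt.congr_deriv ((hasDerivAt_const x (6*a)).div (hwd x) this) ?_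
    field_simp
    ring
  set z : ℂ → ℂ := fun x => x^3/(4-3*x)^2 with hz
  have hFz : ∀ x : ℂ, ‖x‖ < 1/2 → HasDerivAt (fun x => F (z x))
      ((12*x^2-3*x^3)/(4-3*x)^3 * deriv F (z x)) x := by
    intro x hx
    rw [mul_comm]
    exact (hode (z x) (hzl x hx)).1.hasDerivAt.comp x (hzd x hx)
  have hF1z : ∀ x : ℂ, ‖x‖ < 1/2 → HasDerivAt (fun x => deriv F (z x))
      ((12*x^2-3*x^3)/(4-3*x)^3 * deriv (deriv F) (z x)) x := by
    intro x hx
    rw [mul_comm]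
    exact (hode (z x) (hzl x hx)).2.1.hasDerivAt.comp x (hzd x hx)
  have hg1 : ∀ x : ℂ, ‖x‖ < 1/2 → HasDerivAt (fun x => P x * F (z x))
      (P x * ((6*a/(4-3*x)) * F (z x) + (12*x^2-3*x^3)/(4-3*x)^3 * deriv F (z x))) x := by
    intro x hx
    refine HasDerivAt.congr_deriv ((deriv_P a x hx).mul (hFz x hx)) ?_
    simp only [hP]; ring
  have hg2 : ∀ x : ℂ, ‖x‖ < 1/2 → HasDerivAt (deriv (fun x => P x * F (z x)))
      (P x * ((6*a/(4-3*x)) * ((6*a/(4-3*x)) * F (z x)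
          + (12*x^2-3*x^3)/(4-3*x)^3*deriv F (z x)) +
      ((18*a/(4-3*x)^2) * F (z x) + (6*a/(4-3*x)) * ((12*x^2-3*x^3)/(4-3*x)^3*deriv F (z x)) +
      (((24*x - 9*x^2)*(4-3*x) + 9*(12*x^2-3*x^3))/(4-3*x)^4 *deriv F (z x)
        + (12*x^2-3*x^3)/(4-3*x)^3*((12*x^2-3*x^3)/(4-3*x)^3*deriv (deriv F) (z x)))))) x := by
    intro x hx
    have hev : deriv (fun x => P x * F (z x)) =ᶠ[nhds x] fun x =>
        P x * ((6*a/(4-3*x)) * F (z x) + (12*x^2-3*x^3)/(4-3*x)^3 * deriv F (z x)) := by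
      have : Metric.ball (0:ℂ) (1/2) ∈ nhds x := Metric.isOpen_ball.mem_nhds (by simpa using hx)
      filter_upwards [this] with y hy
      exact (hg1 y (by simpa using hy)).deriv
    refine HasDerivAt.congr_of_eventuallyEq ?_ hev
    refine HasDerivAt.congr_deriv ((deriv_P a x hx).mul (((hQd x hx).mul (hFz x hx)).add
      ((hzdd x hx).mul (hF1z x hx)))) ?_
    simp only [hP]
    ring
  refine ⟨Metric.ball 0 (1/2), Metric.isOpen_ball, by simp, ?_⟩
  intro x hxU hx0 hx1 _
  have hx : ‖x‖ < 1/2 := by simpa using hxU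
  have hfin := alg_final a b x (P x) (F (z x)) (deriv F (z x)) (deriv (deriv F) (z x))
    (hw0 x hx) hx0 (sub_ne_zero.2 hx1) (hode (z x) (hzl x hx)).2.2
  have e1 := (hg1 x hx).deriv
  have e2 := (hg2 x hx).deriv
  change SatisfiesHeunAt (4/3) (6*a^2 + 6*a*b - a) (3*a) (2*a + b) (3*a + 3*b - 1/2) (1/2)
    (fun x => P x * F (z x)) x
  refine ⟨(hg1 x hx).differentiableAt, (hg2 x hx).differentiableAt, ?_⟩
  rw [e2, e1]
  exact hfin
end

section
/- Let a, b ∈ ℂ with a + b + 1/2 not a nonpositive integer. Then there is an open neighborhood U of 0 in ℂ such that the function g(x) = (1 - 8x/9)^(-3a) · ₂F₁(a, b; a+b+1/2; 64x³(1-x)/(9-8x)³) satisfies Heun's differential equation with parameters (t, q; a', b'; c'; d') = (9/8, 9a² + 9ab - 3a/2; 4a, 3a+b; 3a+3b-1/2; a+b+1/2) at every x ∈ U with x ∉ {0, 1, 9/8}. -/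
open Complex

lemma aux_hyp_radius_pos (a b c : ℂ) : 0 < (ordinaryHypergeometricSeries ℂ a b c).radius := by
  by_cases h : ∀ kn : ℕ, (kn : ℂ) ≠ -a ∧ (kn : ℂ) ≠ -b ∧ (kn : ℂ) ≠ -c
  · rw [ordinaryHypergeometricSeries_radius_eq_one ℂ a b c h]; exact one_pos
  · push Not at h
    obtain ⟨k, hk⟩ := h
    by_cases h1 : (k : ℂ) = -a
    · have : a = -(k : ℂ) := by rw [h1, neg_neg]
      rw [this, ordinaryHypergeometric_radius_top_of_neg_nat₁]; simp
    by_cases h2 : (k : ℂ) = -b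
    · have : b = -(k : ℂ) := by rw [h2, neg_neg]
      rw [this, ordinaryHypergeometric_radius_top_of_neg_nat₂]; simp
    have : c = -(k : ℂ) := by rw [hk h1 h2, neg_neg]
    rw [this, ordinaryHypergeometric_radius_top_of_neg_nat₃]; simp

lemma aux_hasSum_shift (f : ℕ → ℂ) (s : ℂ) (h0 : f 0 = 0)
    (h : HasSum (fun n => f (n + 1)) s) : HasSum f s := by
  have := (hasSum_nat_add_iff (f := f) 1).1 h
  simpa [h0] using this

lemma aux_hyp_ode (a b c : ℂ) (hc : ∀ n : ℕ, c ≠ -(n : ℂ)) :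
    ∃ r : ℝ, 0 < r ∧ DifferentiableOn ℂ (ordinaryHypergeometric a b c : ℂ → ℂ) (Metric.ball 0 r) ∧
      ∀ z ∈ Metric.ball (0 : ℂ) r,
        z * (1 - z) * deriv (deriv (ordinaryHypergeometric a b c)) z
          + (c - (a + b + 1) * z) * deriv (ordinaryHypergeometric a b c) z
          - a * b * ordinaryHypergeometric a b c z = 0 := by
  have hps := (ordinaryHypergeometricSeries ℂ a b c).hasFPowerSeriesOnBall
    (aux_hyp_radius_pos a b c)
  change HasFPowerSeriesOnBall (ordinaryHypergeometric a b c : ℂ → ℂ) _ _ _ at hps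
  obtain ⟨r, hr0, hr⟩ := ENNReal.lt_iff_exists_real_btwn.1 (aux_hyp_radius_pos a b c)
  have hr0' : 0 < r := by simpa using hr.1
  set F : ℂ → ℂ := ordinaryHypergeometric a b c with hF
  have hd : DifferentiableOn ℂ F (Metric.ball 0 r) := by
    refine hps.differentiableOn.mono ?_
    rw [← Metric.eball_ofReal]
    exact Metric.eball_subset_eball hr.2.le
  refine ⟨r, hr0', hd, ?_⟩
  have hd1 : DifferentiableOn ℂ (deriv F) (Metric.ball 0 r) := hd.deriv Metric.isOpen_ball
  have hd2 : DifferentiableOn ℂ (deriv (deriv F)) (Metric.ball 0 r) :=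
    hd1.deriv Metric.isOpen_ball
  have hs : ∀ n, iteratedDeriv n F 0 = (ascPochhammer ℂ n).eval a * (ascPochhammer ℂ n).eval b *
        ((ascPochhammer ℂ n).eval c)⁻¹ := by
    intro n
    have := hps.factorial_smul 1 n
    rw [iteratedDeriv_eq_iteratedFDeriv, ← this, ordinaryHypergeometricSeries_apply_eq]
    have hn : (n.factorial : ℂ) ≠ 0 := by exact_mod_cast n.factorial_ne_zero
    simp only [one_pow, nsmul_eq_mul, smul_eq_mul, mul_one]
    field_simp
  have hrec : ∀ n : ℕ, (c + n) * iteratedDeriv (n + 1) F 0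
      = (a + n) * (b + n) * iteratedDeriv n F 0 := by
    intro n
    rw [hs, hs, ascPochhammer_succ_eval, ascPochhammer_succ_eval, ascPochhammer_succ_eval]
    have h1 : c + n ≠ 0 := fun h => hc n (eq_neg_of_add_eq_zero_left h)
    rw [mul_inv]
    field_simp
  intro z hz
  have H0 := hasSum_taylorSeries_on_ball hd hz
  have H1 := hasSum_taylorSeries_on_ball hd1 hz
  have H2 := hasSum_taylorSeries_on_ball hd2 hz
  simp only [← iteratedDeriv_succ', sub_zero, smul_eq_mul] at H0 H1 H2
  set s : ℕ → ℂ := fun n => iteratedDeriv n F 0 with hsdef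
  have fac : ∀ n : ℕ, ((n + 1).factorial : ℂ) = (n + 1) * n.factorial := by
    intro n; rw [Nat.factorial_succ]; push_cast; ring
  have fac0 : ∀ n : ℕ, (n.factorial : ℂ) ≠ 0 := fun n => by exact_mod_cast n.factorial_ne_zero
  have n1 : ∀ n : ℕ, (n : ℂ) + 1 ≠ 0 := fun n => by exact_mod_cast n.succ_ne_zero
  have K1 : HasSum (fun n : ℕ => (n.factorial : ℂ)⁻¹ * (z ^ n * (n * s (n + 1))))
      (z * deriv (deriv F) z) := by
    apply aux_hasSum_shift _ _ (by simp)
    refine (H2.mul_left z).congr_fun ?_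
    intro n
    have := fac0 n
    have := n1 n
    rw [fac]; push_cast
    simp only [hsdef]
    field_simp
    ring
  have K2 : HasSum (fun n : ℕ => (n.factorial : ℂ)⁻¹ * (z ^ n * (n * s n)))
      (z * deriv F z) := by
    apply aux_hasSum_shift _ _ (by simp)
    refine (H1.mul_left z).congr_fun ?_
    intro n
    have := fac0 n
    have := n1 n
    rw [fac]; push_cast
    simp only [hsdef]
    field_simp
    ring
  have K3 : HasSum (fun n : ℕ => (n.factorial : ℂ)⁻¹ * (z ^ n * (n * (n - 1) * s n)))
      (z * (z * deriv (deriv F) z)) := by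
    apply aux_hasSum_shift _ _ (by simp)
    refine (K1.mul_left z).congr_fun ?_
    intro n
    have := fac0 n
    have := n1 n
    rw [fac]; push_cast
    simp only [hsdef]
    field_simp
    ring
  have T := (((K1.sub K3).add (H1.mul_left c)).sub (K2.mul_left (a + b + 1))).sub
    (H0.mul_left (a * b))
  have T0 := T.unique (a₂ := 0) ?_
  · linear_combination T0
  · convert hasSum_zero using 1
    funext n
    have := hrec n
    simp only [hsdef]
    linear_combination (n.factorial : ℂ)⁻¹ * z ^ n * this

lemma aux_heun_alg (a b x p F F1 F2 D: ℂ) (hx : x ≠ 0) (hx1 : x - 1 ≠ 0) (hD : D ≠ 0)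
    (hDx : D = 9 - 8 * x) (z : ℂ) (hz : z = 64*x^3*(1-x) / D^3)
    (ode : z * (1 - z) * F2 + ((a+b+1/2) - (a + b + 1) * z) * F1 - a * b * F = 0) :
    p * (24*a/D * (24*a/D * F + 64*x^2*(27-36*x+8*x^2)/D^4 * F1) + 192*a/D^2 * F
      + 24*a/D * (64*x^2*(27-36*x+8*x^2)/D^4 * F1)
      + (64*(54*x-108*x^2+32*x^3)/D^4 + 64*32*x^2*(27-36*x+8*x^2)/D^5) * F1
      + (64*x^2*(27-36*x+8*x^2)/D^4)^2 * F2)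
    + ((3*a + 3*b - 1/2) / x + (a + b + 1/2) / (x - 1) +
       ((4*a) + (3*a + b) - (3*a + 3*b - 1/2) - (a + b + 1/2) + 1) / (x - 9/8)) *
       (p * (24*a/D * F + 64*x^2*(27-36*x+8*x^2)/D^4 * F1))
    + (((4*a) * (3*a + b) * x - (9*a^2 + 9*a*b - 3*a/2)) / (x * (x - 1) * (x - 9/8))) * (p * F)
     = 0 := by
  have h98 : x - 9/8 = - D / 8 := by rw [hDx]; ring
  rw [h98]
  have h1x : 1 - x ≠ 0 := fun h => hx1 (by linear_combination -h)
  have key : ∀ A B C : ℂ, A = 64*x/((1-x)*D^2) * (z*(1-z)) →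
     B = 64*x/((1-x)*D^2) * ((a+b+1/2) - (a + b + 1) * z) →
     C = 64*x/((1-x)*D^2) * (- (a*b)) → p * (A * F2 + B * F1 + C * F) = 0 := by
    intro A B C hA hB hC
    rw [hA, hB, hC]
    linear_combination p * (64*x/((1-x)*D^2)) * ode
  refine Eq.trans ?_ (key _ _ _ ?_ rfl rfl) (b := p * ((64*x^2*(27-36*x+8*x^2)/D^4)^2 * F2 + _ * F1 + _ * F))
  · rw [hz]
    have e1 : 1 - x = -(x - 1) := by ring
    rw [e1]
    field_simp
    rw [hDx]
    ring
  · rw [hz]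
    field_simp
    rw [hDx]
    ring

theorem stmt14 (a b : ℂ) (hc : ∀ n : ℕ, a + b + 1/2 ≠ -(n : ℂ)) :
    ∃ U : Set ℂ, IsOpen U ∧ (0 : ℂ) ∈ U ∧ ∀ x ∈ U, x ≠ (0 : ℂ) → x ≠ (1 : ℂ) → x ≠ (9/8 : ℂ) →
      SatisfiesHeunAt (9/8) (9*a^2 + 9*a*b - 3*a/2) (4*a) (3*a + b) (3*a + 3*b - 1/2) (a + b + 1/2)
        (fun x : ℂ => (1 - 8*x/9) ^ (-(3*a)) * ordinaryHypergeometric a b (a + b + 1/2) (64*x^3*(1-x) / (9 - 8*x)^3)) x := by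
  obtain ⟨r, hr, hd, hode⟩ := aux_hyp_ode a b (a + b + 1/2) hc
  set F : ℂ → ℂ := ordinaryHypergeometric a b (a + b + 1/2) with hF
  have hd1 : DifferentiableOn ℂ (deriv F) (Metric.ball 0 r) := hd.deriv Metric.isOpen_ball
  have ev : ∀ᶠ x in nhds (0 : ℂ), x ∈ Metric.ball (0 : ℂ) 1 ∧
      64*x^3*(1-x) / (9 - 8*x)^3 ∈ Metric.ball (0 : ℂ) r := by
    refine Filter.Eventually.and (Metric.ball_mem_nhds (0 : ℂ) one_pos) ?_
    have hcont : ContinuousAt (fun x : ℂ => 64*x^3*(1-x) / (9 - 8*x)^3) 0 := by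
      apply ContinuousAt.div (by fun_prop) (by fun_prop) (by norm_num)
    apply hcont.eventually_mem
    simpa using Metric.ball_mem_nhds (0 : ℂ) hr
  obtain ⟨U, hU, hUo, hU0⟩ := eventually_nhds_iff.1 ev
  refine ⟨U, hUo, hU0, ?_⟩
  have hslit : ∀ x ∈ U, 1 - 8*x/9 ∈ slitPlane := by
    intro x hx
    have h1 : ‖x‖ < 1 := by simpa using (hU x hx).1
    left
    have := Complex.re_le_norm x
    have e : (1 - 8*x/9).re = 1 - 8 * x.re / 9 := by
      have : 1 - 8*x/9 = 1 - ((8/9 : ℝ) : ℂ) * x := by push_cast; ring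
      rw [this, sub_re, re_ofReal_mul, one_re]; ring
    rw [e]; linarith
  have hDne : ∀ x ∈ U, (9 : ℂ) - 8*x ≠ 0 := by
    intro x hx h
    apply slitPlane_ne_zero (hslit x hx)
    linear_combination h / 9
  have hp : ∀ x ∈ U, HasDerivAt (fun x : ℂ => (1 - 8*x/9) ^ (-(3*a)))
      ((1 - 8*x/9) ^ (-(3*a)) * (24*a/(9-8*x))) x := by
    intro x hx
    have hl : HasDerivAt (fun x : ℂ => 1 - 8*x/9) (-(8/9)) x := by
      have := (((hasDerivAt_id x).const_mul (8 : ℂ)).div_const 9).const_sub 1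
      simpa using this
    convert! hl.cpow_const (c := -(3*a)) (hslit x hx) using 1
    rw [cpow_sub _ _ (slitPlane_ne_zero (hslit x hx)), cpow_one]
    have h1 := slitPlane_ne_zero (hslit x hx)
    have h2 := hDne x hx
    have e : 1 - 8*x/9 = (9 - 8*x)/9 := by ring
    generalize (1 - 8*x/9) ^ (-(3*a)) = w
    rw [e]
    field_simp
    ring
  have hz : ∀ x ∈ U, HasDerivAt (fun x : ℂ => 64*x^3*(1-x) / (9 - 8*x)^3)
      (64*x^2*(27-36*x+8*x^2)/(9-8*x)^4) x := by
    intro x hx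
    have h2 := hDne x hx
    have hi := hasDerivAt_id' x
    have hn := ((hi.pow 3).const_mul 64).mul (hi.const_sub 1)
    have hdn := ((hi.const_mul 8).const_sub 9).pow 3
    convert! hn.div hdn (pow_ne_zero 3 h2) using 1
    simp only [Pi.pow_apply, Pi.mul_apply]
    obtain ⟨D, hD⟩ : ∃ D : ℂ, D = 9 - 8 * x := ⟨_, rfl⟩
    rw [← hD] at h2 ⊢
    push_cast
    field_simp
    rw [hD]
    ring
  have hz2 : ∀ x ∈ U, HasDerivAt (fun x : ℂ => 64*x^2*(27-36*x+8*x^2)/(9-8*x)^4)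
      (64*(54*x-108*x^2+32*x^3)/(9-8*x)^4 + 64*32*x^2*(27-36*x+8*x^2)/(9-8*x)^5) x := by
    intro x hx
    have h2 := hDne x hx
    have hi := hasDerivAt_id' x
    have hn := ((hi.pow 2).const_mul 64).mul
      (((hi.const_mul 36).const_sub 27).add ((hi.pow 2).const_mul 8))
    have hdn := ((hi.const_mul 8).const_sub 9).pow 4
    convert! hn.div hdn (pow_ne_zero 4 h2) using 1
    simp only [Pi.pow_apply, Pi.mul_apply, Pi.add_apply]
    obtain ⟨D, hD⟩ : ∃ D : ℂ, D = 9 - 8 * x := ⟨_, rfl⟩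
    rw [← hD] at h2 ⊢
    push_cast
    field_simp
    rw [hD]
    ring
  have hA : ∀ x ∈ U, HasDerivAt (fun x : ℂ => 24*a/(9-8*x)) (192*a/(9-8*x)^2) x := by
    intro x hx
    have h2 := hDne x hx
    have hi := hasDerivAt_id' x
    convert! (hasDerivAt_const x (24*a)).div ((hi.const_mul 8).const_sub 9) h2 using 1
    ring
  have hFd : ∀ x ∈ U, HasDerivAt (fun x : ℂ => F (64*x^3*(1-x) / (9 - 8*x)^3))
      (deriv F (64*x^3*(1-x) / (9 - 8*x)^3) * (64*x^2*(27-36*x+8*x^2)/(9-8*x)^4)) x := by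
    intro x hx
    exact HasDerivAt.comp x
      (hd.differentiableAt (Metric.isOpen_ball.mem_nhds (hU x hx).2)).hasDerivAt (hz x hx)
  have hFd1 : ∀ x ∈ U, HasDerivAt (fun x : ℂ => deriv F (64*x^3*(1-x) / (9 - 8*x)^3))
      (deriv (deriv F) (64*x^3*(1-x) / (9 - 8*x)^3) * (64*x^2*(27-36*x+8*x^2)/(9-8*x)^4)) x := by
    intro x hx
    exact HasDerivAt.comp x
      (hd1.differentiableAt (Metric.isOpen_ball.mem_nhds (hU x hx).2)).hasDerivAt (hz x hx)
  have hg : ∀ x ∈ U, HasDerivAt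
      (fun x : ℂ => (1 - 8*x/9) ^ (-(3*a)) * F (64*x^3*(1-x) / (9 - 8*x)^3))
      ((1 - 8*x/9) ^ (-(3*a)) * (24*a/(9-8*x) * F (64*x^3*(1-x) / (9 - 8*x)^3)
        + 64*x^2*(27-36*x+8*x^2)/(9-8*x)^4 * deriv F (64*x^3*(1-x) / (9 - 8*x)^3))) x := by
    intro x hx
    convert! (hp x hx).mul (hFd x hx) using 1
    ring
  intro x hx hx0 hx1 hx9
  have hg2 := (hp x hx).mul (((hA x hx).mul (hFd x hx)).add ((hz2 x hx).mul (hFd1 x hx)))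
  have hev : deriv (fun x : ℂ => (1 - 8*x/9) ^ (-(3*a)) * F (64*x^3*(1-x) / (9 - 8*x)^3))
      =ᶠ[nhds x] (fun x : ℂ => (1 - 8*x/9) ^ (-(3*a)) *
        (24*a/(9-8*x) * F (64*x^3*(1-x) / (9 - 8*x)^3)
        + 64*x^2*(27-36*x+8*x^2)/(9-8*x)^4 * deriv F (64*x^3*(1-x) / (9 - 8*x)^3))) := by
    filter_upwards [hUo.mem_nhds hx] with y hy using (hg y hy).deriv
  have hg3 := hg2.congr_of_eventuallyEq hev
  refine ⟨(hg x hx).differentiableAt, hg3.differentiableAt, ?_⟩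
  rw [hg3.deriv, (hg x hx).deriv]
  have fin := aux_heun_alg a b x ((1 - 8*x/9) ^ (-(3*a))) _ _ _ (9-8*x) hx0 (sub_ne_zero.2 hx1)
    (hDne x hx) rfl _ rfl (hode _ (hU x hx).2)
  simp only [Pi.mul_apply, Pi.add_apply]
  linear_combination fin
end
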